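/- arXiv:1510.02252 — 7 statements merged into one kernel-verified Lean document; each statement's English description precedes it below -/
import Mathlib

section
/- Let λ₁, λ₂, λ₃ be real numbers with λ₁ < −1, 0 < λ₂ < 1, −1 < λ₃ < 0, λ₂ > |λ₃|, and λ₁λ₂ < −1. Set A = λ₁ + λ₂ + λ₃, C = −(λ₁λ₂ + λ₁λ₃ + λ₂λ₃), B = λ₁λ₂λ₃. Then C > A + B + 1, C < 1 − B − A, A·C + B < 0, and C > 1 + A·B + B². -/
theorem stmt_0 (l1 l2 l3 A B C : ℝ)
    (h1 : l1 < -1) (h2a : 0 < l2) (h2b : l2 < 1)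
    (h3a : -1 < l3) (h3b : l3 < 0)
    (hlead : l2 > |l3|) (hsigma : l1 * l2 < -1)
    (hA : A = l1 + l2 + l3)
    (hC : C = -(l1 * l2 + l1 * l3 + l2 * l3))
    (hB : B = l1 * l2 * l3) :
    C > A + B + 1 ∧ C < 1 - B - A ∧ A * C + B < 0 ∧ C > 1 + A * B + B ^ 2 := by
  subst hA hC hB
  rw [abs_of_neg h3b] at hlead
  refine ⟨?_, ?_, ?_, ?_⟩
  · have h : 0 < (-1 - l1) * (1 + l2) * (1 + l3) :=
      mul_pos (mul_pos (by linarith) (by linarith)) (by linarith)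
    linarith
  · have h : 0 < (1 - l1) * (1 - l2) * (1 - l3) :=
      mul_pos (mul_pos (by linarith) (by linarith)) (by linarith)
    linarith
  · have h : 0 < -(l1 + l2) * -(l1 + l3) * (l2 + l3) :=
      mul_pos (mul_pos (by linarith) (by linarith)) (by linarith)
    linarith
  · have h : 0 < (-1 - l1 * l2) * (1 + l1 * l3) * (1 + l2 * l3) :=
      mul_pos (mul_pos (by linarith) (by nlinarith)) (by nlinarith)
    linarith
end

section
/- Let λ₁, λ₂, λ₃ be real numbers with λ₁ < −1, 0 < λ₂ < 1, −1 < λ₃ < 0, λ₂ < |λ₃|, and λ₁λ₃ > 1. Set A = λ₁ + λ₂ + λ₃, C = −(λ₁λ₂ + λ₁λ₃ + λ₂λ₃), B = λ₁λ₂λ₃. Then C > A + B + 1, C < 1 − B − A, A·C + B > 0, and C < −1 − A·B + B². -/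
theorem stmt_1 (l1 l2 l3 A B C : ℝ)
    (h1 : l1 < -1) (h2a : 0 < l2) (h2b : l2 < 1)
    (h3a : -1 < l3) (h3b : l3 < 0)
    (hlead : l2 < |l3|) (hsigma : l1 * l3 > 1)
    (hA : A = l1 + l2 + l3)
    (hC : C = -(l1 * l2 + l1 * l3 + l2 * l3))
    (hB : B = l1 * l2 * l3) :
    C > A + B + 1 ∧ C < 1 - B - A ∧ A * C + B > 0 ∧ C < -1 - A * B + B ^ 2 := by
  rw [abs_of_neg h3b] at hlead
  subst hA hC hB
  refine ⟨?_, ?_, ?_, ?_⟩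
  · have h : 0 < (-1 - l1) * (1 + l2) * (1 + l3) :=
      mul_pos (mul_pos (by linarith) (by linarith)) (by linarith)
    linear_combination h
  · have h : 0 < (1 - l1) * (1 - l2) * (1 - l3) :=
      mul_pos (mul_pos (by linarith) (by linarith)) (by linarith)
    linear_combination h
  · have h : 0 < (-l1 - l2) * (-l1 - l3) * (-l2 - l3) :=
      mul_pos (mul_pos (by linarith) (by linarith)) (by linarith)
    linear_combination h
  · have h12 : l1 * l2 < 0 := mul_neg_of_neg_of_pos (by linarith) h2a
    have h23 : l2 * l3 < 0 := mul_neg_of_pos_of_neg h2a h3b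
    have h : 0 < (1 - l1 * l2) * (l1 * l3 - 1) * (1 - l2 * l3) :=
      mul_pos (mul_pos (by linarith) (by linarith)) (by linarith)
    linear_combination h
end

section
/- Let λ₁, λ₂, λ₃ be real numbers with λ₁ < −1, 0 < λ₂ < 1, −1 < λ₃ < 0, and λ₂ > |λ₃|. Set A = λ₁ + λ₂ + λ₃, C = −(λ₁λ₂ + λ₁λ₃ + λ₂λ₃), B = λ₁λ₂λ₃. Then A·C + B < 0 (equivalently, since A < 0, C > −B/A). -/
theorem stmt_6 (l1 l2 l3 A B C : ℝ)
    (h1 : l1 < -1) (h2a : 0 < l2) (h2b : l2 < 1)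
    (h3a : -1 < l3) (h3b : l3 < 0)
    (hlead : l2 > |l3|)
    (hA : A = l1 + l2 + l3)
    (hC : C = -(l1 * l2 + l1 * l3 + l2 * l3))
    (hB : B = l1 * l2 * l3) :
    A * C + B < 0 := by
  have h12 : l1 + l2 < 0 := by linarith
  have h13 : l1 + l3 < 0 := by linarith
  have h23 : 0 < l2 + l3 := by linarith [neg_abs_le l3]
  have hfactor : A * C + B = -((l1 + l2) * (l1 + l3) * (l2 + l3)) := by
    rw [hA, hC, hB]
    ring
  rw [hfactor, neg_lt_zero]
  exact mul_pos (mul_pos_of_neg_of_neg h12 h13) h23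
end

section
/- Let λ₁, λ₂, λ₃ be real numbers with λ₁ < −1, 0 < λ₂ < 1, and −1 < λ₃ < 0. Set A = λ₁ + λ₂ + λ₃, C = −(λ₁λ₂ + λ₁λ₃ + λ₂λ₃), B = λ₁λ₂λ₃. If A·C + B < 0, then λ₂ > |λ₃|. -/
theorem stmt_7 (l1 l2 l3 A B C : ℝ)
    (h1 : l1 < -1) (h2a : 0 < l2) (h2b : l2 < 1)
    (h3a : -1 < l3) (h3b : l3 < 0)
    (hA : A = l1 + l2 + l3)
    (hC : C = -(l1 * l2 + l1 * l3 + l2 * l3))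
    (hB : B = l1 * l2 * l3)
    (h : A * C + B < 0) :
    l2 > |l3| := by
  have hprod : 0 < (l1 + l2) * (l1 + l3) * (l2 + l3) := by
    subst hA hC hB
    linarith
  have hpos : 0 < (l1 + l2) * (l1 + l3) :=
    mul_pos_of_neg_of_neg (by linarith) (by linarith)
  have hsum : 0 < l2 + l3 := pos_of_mul_pos_right hprod hpos.le
  rw [abs_of_neg h3b]
  linarith
end

section
/- Let λ₁, λ₂, λ₃ be real numbers with λ₁ < −1, 0 < λ₂ < 1, −1 < λ₃ < 0, and λ₂ < |λ₃|. Set A = λ₁ + λ₂ + λ₃, C = −(λ₁λ₂ + λ₁λ₃ + λ₂λ₃), B = λ₁λ₂λ₃. Then A·C + B > 0 (equivalently, since A < 0, C < −B/A). -/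
theorem stmt_8 (l1 l2 l3 A B C : ℝ)
    (h1 : l1 < -1) (h2a : 0 < l2) (h2b : l2 < 1)
    (h3a : -1 < l3) (h3b : l3 < 0)
    (hlead : l2 < |l3|)
    (hA : A = l1 + l2 + l3)
    (hC : C = -(l1 * l2 + l1 * l3 + l2 * l3))
    (hB : B = l1 * l2 * l3) :
    A * C + B > 0 := by
  rw [abs_of_neg h3b] at hlead
  have h12 : 0 < -(l1 + l2) := by linarith
  have h13 : 0 < -(l1 + l3) := by linarith
  have h23 : 0 < -(l2 + l3) := by linarith
  have key : A * C + B = -(l1 + l2) * -(l1 + l3) * -(l2 + l3) := by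
    subst hA hC hB
    ring
  rw [key]
  positivity
end

section
/- Let λ₁, λ₂, λ₃ be real numbers with λ₁ < −1, 0 < λ₂ < 1, −1 < λ₃ < 0, and λ₁λ₂ < −1. Set A = λ₁ + λ₂ + λ₃, C = −(λ₁λ₂ + λ₁λ₃ + λ₂λ₃), B = λ₁λ₂λ₃. Then −B < λ₃, χ(−B) > 0 where χ(λ) = λ³ − Aλ² − Cλ − B, and consequently C > 1 + A·B + B². -/
theorem stmt_10 (l1 l2 l3 A B C : ℝ)
    (h1 : l1 < -1) (h2a : 0 < l2) (h2b : l2 < 1)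
    (h3a : -1 < l3) (h3b : l3 < 0)
    (hsigma : l1 * l2 < -1)
    (hA : A = l1 + l2 + l3)
    (hC : C = -(l1 * l2 + l1 * l3 + l2 * l3))
    (hB : B = l1 * l2 * l3) :
    -B < l3 ∧ (-B) ^ 3 - A * (-B) ^ 2 - C * (-B) - B > 0 ∧ C > 1 + A * B + B ^ 2 := by
  have h12 : 0 < -(1 + l1 * l2) := by linarith
  have h13 : 0 < 1 + l1 * l3 := by nlinarith
  have h23 : 0 < 1 + l2 * l3 := by nlinarith
  have hBpos : 0 < B := hB ▸ mul_pos_of_neg_of_neg (by linarith) h3b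
  have hprod : 0 < (1 + l2 * l3) * (1 + l1 * l3) * -(1 + l1 * l2) :=
    mul_pos (mul_pos h23 h13) h12
  have hχ : (-B) ^ 3 - A * (-B) ^ 2 - C * (-B) - B =
      B * ((1 + l2 * l3) * (1 + l1 * l3) * -(1 + l1 * l2)) := by
    subst hA hB hC
    ring
  have hdiff : C - (1 + A * B + B ^ 2) =
      (1 + l2 * l3) * (1 + l1 * l3) * -(1 + l1 * l2) := by
    subst hA hB hC
    ring
  refine ⟨?_, ?_, ?_⟩
  · nlinarith
  · rw [hχ]
    exact mul_pos hBpos hprod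
  · linarith
end

section
/- Let λ₁, λ₂, λ₃ be real numbers with λ₁ < −1, 0 < λ₂ < 1, −1 < λ₃ < 0, and λ₁λ₃ > 1. Set A = λ₁ + λ₂ + λ₃, C = −(λ₁λ₂ + λ₁λ₃ + λ₂λ₃), B = λ₁λ₂λ₃. Then λ₂ < B, χ(B) > 0 where χ(λ) = λ³ − Aλ² − Cλ − B, and consequently C < −1 − A·B + B². -/
theorem stmt_11 (l1 l2 l3 A B C : ℝ)
    (h1 : l1 < -1) (h2a : 0 < l2) (h2b : l2 < 1)
    (h3a : -1 < l3) (h3b : l3 < 0)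
    (hsigma : l1 * l3 > 1)
    (hA : A = l1 + l2 + l3)
    (hC : C = -(l1 * l2 + l1 * l3 + l2 * l3))
    (hB : B = l1 * l2 * l3) :
    l2 < B ∧ B ^ 3 - A * B ^ 2 - C * B - B > 0 ∧ C < -1 - A * B + B ^ 2 := by
  have hlt : l2 < B := by
    have := mul_pos h2a (sub_pos.mpr hsigma)
    linarith
  have hfactor : B ^ 3 - A * B ^ 2 - C * B - B = (B - l1) * (B - l2) * (B - l3) := by
    subst hA hC
    linear_combination -hB
  have hpos : B ^ 3 - A * B ^ 2 - C * B - B > 0 := by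
    rw [hfactor]
    exact mul_pos (mul_pos (by linarith) (by linarith)) (by linarith)
  refine ⟨hlt, hpos, ?_⟩
  have hprod : 0 < B * (B ^ 2 - A * B - C - 1) := by linarith
  have := pos_of_mul_pos_right hprod (h2a.trans hlt).le
  linarith
end
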